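/- With notation as in the previous statement (S ≅ R[v₁,…,v_r]/(v_i^{e_i} − f_i) with e_i ≥ 2 pairwise coprime), S is regular if and only if one of the following holds: (a) r = 0; (b) r = 1 and f₁ ∈ 𝔪 ∖ 𝔪²; (c) r = 2 and 𝔪 = (f₁, f₂) + 𝔪². -/

import Mathlib

section LocalRing

open IsLocalRing

theorem IsLocalRing.ideal_le_of_le_sup_maximalIdeal_mul {R : Type*} [CommRing R] [IsLocalRing R]
    [IsNoetherianRing R] {N P : Ideal R} (h : P ≤ N ⊔ maximalIdeal R * P) : P ≤ N :=
  Submodule.le_of_le_smul_of_le_jacobson_bot (IsNoetherian.noetherian P)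
    (maximalIdeal_le_jacobson ⊥) h

theorem IsLocalRing.maximalIdeal_ne_span_singleton {R : Type*} [CommRing R] [IsLocalRing R]
    [IsNoetherianRing R] (hdim : ringKrullDim R = 2) (x : R) :
    maximalIdeal R ≠ Ideal.span {x} := by
  intro h
  have hx : ¬ IsUnit x := by
    have : x ∈ maximalIdeal R := h ▸ Ideal.mem_span_singleton_self x
    simpa using this
  have h1 := Ideal.height_span_singleton_le_one hx
  rw [← h] at h1
  have h2 := IsLocalRing.maximalIdeal_height_eq_ringKrullDim (R := R)
  rw [hdim] at h2
  have h3 : ((maximalIdeal R).height : WithBot ℕ∞) ≤ 1 := by exact_mod_cast h1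
  rw [h2] at h3
  exact absurd h3 (by decide)

/-- If the maximal ideal is generated by `x` and `y`, a prime containing `x` but not `y` is
generated by `x`. -/
theorem IsLocalRing.prime_eq_span_singleton_of_mem {R : Type*} [CommRing R] [IsLocalRing R]
    [IsNoetherianRing R] {x y : R} (hm : maximalIdeal R = Ideal.span {x, y})
    {P : Ideal R} [P.IsPrime] (hx : x ∈ P) (hy : y ∉ P) : P = Ideal.span {x} := by
  refine le_antisymm (ideal_le_of_le_sup_maximalIdeal_mul fun p hp ↦ ?_)
    ((Ideal.span_singleton_le_iff_mem P).2 hx)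
  have : p ∈ Ideal.span {x, y} := hm ▸ le_maximalIdeal (Ideal.IsPrime.ne_top ‹_›) hp
  obtain ⟨a, b, rfl⟩ := Ideal.mem_span_pair.1 this
  have hb : b ∈ P := by
    have : b * y ∈ P := (P.add_mem_iff_right (P.mul_mem_left a hx)).1 hp
    exact (Ideal.IsPrime.mem_or_mem ‹_› this).resolve_right hy
  refine Submodule.add_mem_sup (Ideal.mul_mem_left _ _ (Ideal.mem_span_singleton_self x)) ?_
  rw [mul_comm b]
  exact Ideal.mul_mem_mul (hm ▸ Ideal.subset_span (by simp)) hb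

theorem IsLocalRing.uniqueFactorizationMonoid_of_maximalIdeal_eq_span_pair {R : Type*} [CommRing R]
    [IsDomain R] [IsLocalRing R] [IsNoetherianRing R]
    (hreg : ∃ x y : R, maximalIdeal R = Ideal.span {x, y})
    (hdim : ringKrullDim R = 2) : UniqueFactorizationMonoid R := by
  obtain ⟨x, y, hm⟩ := hreg
  have hxm : x ∈ maximalIdeal R := hm ▸ Ideal.subset_span (by simp)
  have hx0 : x ≠ 0 := by
    rintro rfl
    exact maximalIdeal_ne_span_singleton hdim y (by rw [hm, Ideal.span_insert_zero])
  have hxt : Ideal.span {x} ≠ ⊤ := by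
    simpa [Ideal.span_singleton_eq_top] using hxm
  obtain ⟨Q, hQ⟩ := Ideal.nonempty_minimalPrimes hxt
  have hQp : Q.IsPrime := hQ.1.1
  have hxQ : x ∈ Q := hQ.1.2 (Ideal.mem_span_singleton_self x)
  have hyQ : y ∉ Q := by
    intro hy
    have hQm : Q = maximalIdeal R := by
      refine le_antisymm (le_maximalIdeal hQp.ne_top) ?_
      rw [hm, Ideal.span_le]
      rintro z (rfl | rfl) <;> assumption
    have h1 := Ideal.height_le_one_of_isPrincipal_of_mem_minimalPrimes (Ideal.span {x}) Q hQ
    have h2 := IsLocalRing.maximalIdeal_height_eq_ringKrullDim (R := R)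
    rw [hdim, ← hQm] at h2
    have h3 : (Q.height : WithBot ℕ∞) ≤ 1 := by exact_mod_cast h1
    rw [h2] at h3
    exact absurd h3 (by decide)
  have hQx : Q = Ideal.span {x} := prime_eq_span_singleton_of_mem hm hxQ hyQ
  have hxp : Prime x := by
    rw [← Ideal.span_singleton_prime hx0, ← hQx]; exact hQp
  have : (Ideal.span {x}).IsPrime := hQx ▸ hQp
  have hloc : IsLocalRing (R ⧸ Ideal.span {x}) :=
    IsLocalRing.of_surjective' _ Ideal.Quotient.mk_surjective
  have hpir : IsPrincipalIdealRing (R ⧸ Ideal.span {x}) := by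
    refine ((tfae_of_isNoetherianRing_of_isLocalRing_of_isDomain (R ⧸ Ideal.span {x})).out 0 4
      rfl rfl).2 ⟨Ideal.Quotient.mk _ y, ?_⟩
    have : maximalIdeal (R ⧸ Ideal.span {x}) =
        (maximalIdeal R).map (Ideal.Quotient.mk (Ideal.span {x})) :=
      (map_maximalIdeal_of_surjective _ Ideal.Quotient.mk_surjective).symm
    rw [this, hm, Ideal.map_span, Set.image_pair]
    have : Ideal.Quotient.mk (Ideal.span {x}) x = 0 := by simp
    rw [this, Ideal.span_insert_zero]
  refine UniqueFactorizationMonoid.iff_exists_prime_mem_of_isPrime.2 fun P hP0 hP ↦ ?_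
  by_cases hxP : x ∈ P
  · exact ⟨x, hxP, hxp⟩
  obtain ⟨q, hq⟩ := hpir.principal (P.map (Ideal.Quotient.mk (Ideal.span {x})))
  have hqm : q ∈ P.map (Ideal.Quotient.mk (Ideal.span {x})) := by
    rw [hq]; exact Ideal.mem_span_singleton_self q
  obtain ⟨p, hp, rfl⟩ := (Ideal.mem_map_iff_of_surjective _ Ideal.Quotient.mk_surjective).1 hqm
  have hPp : P = Ideal.span {p} := by
    refine le_antisymm (ideal_le_of_le_sup_maximalIdeal_mul fun z hz ↦ ?_)
      ((Ideal.span_singleton_le_iff_mem P).2 hp)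
    have hz' := Ideal.mem_map_of_mem (Ideal.Quotient.mk (Ideal.span {x})) hz
    rw [hq] at hz'
    obtain ⟨c, hc⟩ := Ideal.mem_span_singleton'.1 hz'
    obtain ⟨c, rfl⟩ := Ideal.Quotient.mk_surjective c
    rw [← map_mul, eq_comm, Ideal.Quotient.eq, Ideal.mem_span_singleton'] at hc
    obtain ⟨t, ht⟩ := hc
    have htP : t ∈ P := by
      have : t * x ∈ P := ht ▸ P.sub_mem hz (P.mul_mem_left c hp)
      exact (hP.mem_or_mem this).resolve_right hxP
    rw [show z = c * p + x * t by linear_combination -ht]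
    exact Submodule.add_mem_sup (Ideal.mul_mem_left _ _ (Ideal.mem_span_singleton_self p))
      (Ideal.mul_mem_mul hxm htP)
  refine ⟨p, hp, ?_⟩
  rw [← Ideal.span_singleton_prime, ← hPp]
  · exact hP
  · rintro rfl
    exact hP0 (by simpa using hPp)

theorem IsLocalRing.exists_root_one_of_isAdicComplete {R : Type*} [CommRing R] [IsDomain R]
    [IsLocalRing R] [IsAdicComplete (maximalIdeal R) R] [IsAlgClosed (ResidueField R)]
    (d : ℕ) (hd : d ≠ 0) (hdu : IsUnit (d : R)) : ∃ ζ : R, IsPrimitiveRoot ζ d := by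
  have hdk : (d : ResidueField R) ≠ 0 := by
    have := hdu.map (residue R)
    rw [map_natCast] at this
    exact this.ne_zero
  have : NeZero (d : ResidueField R) := ⟨hdk⟩
  obtain ⟨z, hz⟩ := HasEnoughRootsOfUnity.exists_primitiveRoot (ResidueField R) d
  obtain ⟨z, rfl⟩ := residue_surjective z
  have hH : HenselianRing R (maximalIdeal R) := inferInstance
  obtain ⟨ζ, h1, h2⟩ := hH.is_henselian (Polynomial.X ^ d - 1) (Polynomial.monic_X_pow_sub_C _ hd)
    z (by
      rw [← residue_eq_zero_iff]
      simp [hz.pow_eq_one]) (by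
      have h0 : residue R z ≠ 0 := hz.ne_zero hd
      change IsUnit (residue R _)
      simp [Polynomial.derivative_X_pow, h0, hdk])
  have h1' : ζ ^ d = 1 := by simpa [sub_eq_zero] using h1
  have h3 : residue R ζ = residue R z := by
    rwa [← sub_eq_zero, ← map_sub, residue_eq_zero_iff]
  refine ⟨ζ, h1', fun l hl ↦ hz.dvd_of_pow_eq_one _ ?_⟩
  rw [← h3, ← map_pow, hl, map_one]

end LocalRing

section Graded

open IsLocalRing

variable {R S G : Type*} [CommRing R] [CommRing S] [Algebra R S]
  [AddCommGroup G] {b : Module.Basis G R S} {θ : G → G → R}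

theorem Module.Basis.pow_eq_smul_of_twisted (hmul : ∀ i j, b i * b j = θ i j • b (i + j))
    (hb0 : b 0 = 1) (i : G) (n : ℕ) : ∃ c : R, b i ^ n = c • b (n • i) := by
  induction n with
  | zero => exact ⟨1, by simp [hb0]⟩
  | succ n ih =>
    obtain ⟨c, hc⟩ := ih
    exact ⟨c * θ (n • i) i, by rw [pow_succ, hc, smul_mul_assoc, hmul, smul_smul, succ_nsmul]⟩

variable [Fintype G]

theorem Module.Basis.repr_mul_of_twisted (hmul : ∀ i j, b i * b j = θ i j • b (i + j))
    (s t : S) (l : G) :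
    b.repr (s * t) l = ∑ i, b.repr s i * b.repr t (l - i) * θ i (l - i) := by
  classical
  conv_lhs => rw [← b.sum_repr s, ← b.sum_repr t]
  simp only [Finset.sum_mul_sum, smul_mul_smul_comm, hmul, map_sum, Finsupp.coe_finsetSum,
    Finset.sum_apply, map_smul, Finsupp.coe_smul, Pi.smul_apply, Module.Basis.repr_self, smul_eq_mul]
  refine Finset.sum_congr rfl fun i _ ↦ ?_
  rw [Finset.sum_eq_single (l - i)]
  · simp
  · intro j _ hj
    rw [Finsupp.single_eq_of_ne]
    · simp
    · rintro rfl
      simp at hj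
  · simp

theorem Module.Basis.repr_mul_sub_mem (hmul : ∀ i j, b i * b j = θ i j • b (i + j))
    (hb0 : b 0 = 1) {J : Ideal R} (s t : S) (l : G)
    (h : ∀ i, i ≠ 0 → b.repr t (l - i) * θ i (l - i) ∈ J) :
    b.repr (s * t) l - b.repr s 0 * b.repr t l ∈ J := by
  classical
  have h0 : θ 0 l = 1 := by
    have := congr_arg (fun z ↦ b.repr z l) (hmul 0 l)
    simpa [hb0] using this.symm
  rw [b.repr_mul_of_twisted hmul, ← Finset.add_sum_erase _ _ (Finset.mem_univ 0)]
  simp only [sub_zero, h0, mul_one, add_sub_cancel_left]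
  refine J.sum_mem fun i hi ↦ ?_
  rw [mul_assoc]
  exact J.mul_mem_left _ (h i (Finset.ne_of_mem_erase hi))

variable [IsLocalRing R] [Algebra.IsIntegral R S]

theorem Ideal.IsMaximal.algebraMap_mem_iff_of_isLocalRing {I : Ideal S} (hI : I.IsMaximal) (r : R) :
    algebraMap R S r ∈ I ↔ r ∈ maximalIdeal R := by
  have := Ideal.isMaximal_comap_of_isIntegral_of_isMaximal (R := R) I
  rw [← IsLocalRing.eq_maximalIdeal this, Ideal.mem_comap]

theorem Module.Basis.mem_of_isMaximal_of_twisted (hmul : ∀ i j, b i * b j = θ i j • b (i + j))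
    (hb0 : b 0 = 1) (hneg : ∀ i, i ≠ 0 → θ i (-i) ∈ maximalIdeal R)
    {I : Ideal S} (hI : I.IsMaximal) {i : G} (hi : i ≠ 0) : b i ∈ I := by
  have hcard : 1 ≤ Fintype.card G := Fintype.card_pos
  obtain ⟨c, hc⟩ := b.pow_eq_smul_of_twisted hmul hb0 i (Fintype.card G - 1)
  refine hI.isPrime.mem_of_pow_mem (Fintype.card G) ?_
  have h1 : (Fintype.card G - 1) • i = -i := by
    rw [eq_neg_iff_add_eq_zero, ← succ_nsmul, Nat.sub_add_cancel hcard, card_nsmul_eq_zero]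
  rw [← Nat.sub_add_cancel hcard, pow_succ', hc, h1, mul_smul_comm, hmul, add_neg_cancel, hb0,
    smul_smul, ← Algebra.algebraMap_eq_smul_one, hI.algebraMap_mem_iff_of_isLocalRing]
  exact Ideal.mul_mem_left _ _ (hneg i hi)

theorem Module.Basis.mem_iff_of_isMaximal_of_twisted
    (hmul : ∀ i j, b i * b j = θ i j • b (i + j))
    (hb0 : b 0 = 1) (hneg : ∀ i, i ≠ 0 → θ i (-i) ∈ maximalIdeal R)
    {I : Ideal S} (hI : I.IsMaximal) (s : S) : s ∈ I ↔ b.repr s 0 ∈ maximalIdeal R := by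
  classical
  rw [← hI.algebraMap_mem_iff_of_isLocalRing (b.repr s 0)]
  conv_lhs => rw [← b.sum_repr s, ← Finset.add_sum_erase _ _ (Finset.mem_univ 0)]
  rw [hb0, ← Algebra.algebraMap_eq_smul_one]
  refine I.add_mem_iff_left (I.sum_mem fun i hi ↦ ?_)
  rw [Algebra.smul_def]
  exact I.mul_mem_left _
    (b.mem_of_isMaximal_of_twisted hmul hb0 hneg hI (Finset.ne_of_mem_erase hi))

theorem Module.Basis.isMaximal_eq_span_of_twisted {ι : Type*} {f : ι → R} {idx : ι → G}
    (hmul : ∀ i j, b i * b j = θ i j • b (i + j))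
    (hb0 : b 0 = 1) (hneg : ∀ i, i ≠ 0 → θ i (-i) ∈ maximalIdeal R) (hidx : ∀ j, idx j ≠ 0)
    (hgen : ∀ i, i ≠ 0 → ∃ j, θ (i - idx j) (idx j) = 1)
    (hf : ∀ j, θ (idx j) (-idx j) = f j)
    {J : Ideal R} (hJ : maximalIdeal R = Ideal.span (Set.range f) ⊔ J)
    {I : Ideal S} (hI : I.IsMaximal) :
    I = Ideal.span (Set.range fun j ↦ b (idx j)) ⊔ J.map (algebraMap R S) := by
  classical
  set I' := Ideal.span (Set.range fun j ↦ b (idx j)) ⊔ J.map (algebraMap R S) with hI'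
  have hbj : ∀ j, b (idx j) ∈ I' := fun j ↦
    Ideal.mem_sup_left (Ideal.subset_span ⟨j, rfl⟩)
  have hbi : ∀ i, i ≠ 0 → b i ∈ I' := fun i hi ↦ by
    obtain ⟨j, hj⟩ := hgen i hi
    have := hmul (i - idx j) (idx j)
    rw [hj, one_smul, sub_add_cancel] at this
    rw [← this]
    exact I'.mul_mem_left _ (hbj j)
  have hm : (maximalIdeal R).map (algebraMap R S) ≤ I' := by
    rw [hJ, Ideal.map_sup, Ideal.map_span, sup_le_iff, Ideal.span_le]
    refine ⟨?_, le_sup_right⟩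
    rintro _ ⟨_, ⟨j, rfl⟩, rfl⟩
    have := hmul (idx j) (-idx j)
    rw [hf, add_neg_cancel, hb0, ← Algebra.algebraMap_eq_smul_one] at this
    rw [← this]
    exact I'.mul_mem_right _ (hbj j)
  apply le_antisymm
  · intro s hs
    rw [b.mem_iff_of_isMaximal_of_twisted hmul hb0 hneg hI] at hs
    rw [← b.sum_repr s]
    refine I'.sum_mem fun i _ ↦ ?_
    rw [Algebra.smul_def]
    by_cases hi : i = 0
    · rw [hi]
      exact I'.mul_mem_right _ (hm (Ideal.mem_map_of_mem _ hs))
    · exact I'.mul_mem_left _ (hbi i hi)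
  · rw [hI', sup_le_iff, Ideal.span_le, Ideal.map_le_iff_le_comap]
    constructor
    · rintro _ ⟨j, rfl⟩
      exact b.mem_of_isMaximal_of_twisted hmul hb0 hneg hI (hidx j)
    · intro r hr
      rw [Ideal.mem_comap, hI.algebraMap_mem_iff_of_isLocalRing, hJ]
      exact Ideal.mem_sup_right hr

/-- The span, in the cotangent space of a local ring, of the classes of a family of non-units. -/
noncomputable def IsLocalRing.cotangentSpan {R ι : Type*} [CommRing R] [IsLocalRing R] (f : ι → R)
    (hfm : ∀ j, f j ∈ maximalIdeal R) : Submodule (ResidueField R) (CotangentSpace R) :=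
  Submodule.span _ (Set.range fun j ↦ (maximalIdeal R).toCotangent ⟨f j, hfm j⟩)

theorem IsLocalRing.toCotangent_mem_cotangentSpan_iff {R ι : Type*} [Finite ι] [CommRing R]
    [IsLocalRing R] {f : ι → R} (hfm : ∀ j, f j ∈ maximalIdeal R) (z : maximalIdeal R) :
    (maximalIdeal R).toCotangent z ∈ cotangentSpan f hfm ↔
      (z : R) ∈ Ideal.span (Set.range f) ⊔ maximalIdeal R ^ 2 := by
  have := Fintype.ofFinite ι
  rw [cotangentSpan, Submodule.mem_span_range_iff_exists_fun, Submodule.mem_sup]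
  constructor
  · rintro ⟨c, hc⟩
    choose c' hc' using fun j ↦ residue_surjective (c j)
    refine ⟨∑ j, c' j * f j, Ideal.sum_mem _ fun j _ ↦ Ideal.mul_mem_left _ _
      (Ideal.subset_span ⟨j, rfl⟩), z - ∑ j, c' j * f j, ?_, by ring⟩
    have : (maximalIdeal R).toCotangent z =
        (maximalIdeal R).toCotangent (∑ j, c' j • ⟨f j, hfm j⟩) := by
      rw [← hc, map_sum]
      refine Finset.sum_congr rfl fun j _ ↦ ?_
      rw [map_smul, ← hc' j]
      rfl
    rw [Ideal.toCotangent_eq] at this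
    simpa using this
  · rintro ⟨y, hy, w, hw, hz⟩
    obtain ⟨c, rfl⟩ := (Ideal.mem_span_range_iff_exists_fun).1 hy
    refine ⟨fun j ↦ residue R (c j), ?_⟩
    have : (maximalIdeal R).toCotangent (∑ j, c j • ⟨f j, hfm j⟩) =
        (maximalIdeal R).toCotangent z := by
      rw [eq_comm, Ideal.toCotangent_eq]
      simpa [← hz] using hw
    rw [← this, map_sum]
    refine Finset.sum_congr rfl fun j _ ↦ ?_
    rw [map_smul]
    rfl

theorem Module.Basis.card_add_finrank_le_of_twisted {ι : Type*} [Fintype ι] [IsNoetherianRing R]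
    {f : ι → R} {idx : ι → G}
    (hfm : ∀ j, f j ∈ maximalIdeal R)
    (hmul : ∀ i j, b i * b j = θ i j • b (i + j))
    (hb0 : b 0 = 1) (hneg : ∀ i, i ≠ 0 → θ i (-i) ∈ Ideal.span (Set.range f))
    (hidx : ∀ j, idx j ≠ 0) (hinj : Function.Injective idx)
    (hdec : ∀ i k j, i ≠ 0 → k ≠ 0 → i + k = idx j → θ i k ∈ maximalIdeal R)
    {I : Ideal S} (hI : I.IsMaximal) {x y : S} (hxy : I = Ideal.span {x, y}) :
    Fintype.card ι +
      Module.finrank (ResidueField R) (CotangentSpace R ⧸ cotangentSpan f hfm) ≤ 2 := by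
  classical
  have hfle : Ideal.span (Set.range f) ≤ maximalIdeal R := by
    rw [Ideal.span_le]
    rintro _ ⟨j, rfl⟩
    exact hfm j
  have hmem := b.mem_iff_of_isMaximal_of_twisted hmul hb0 (fun i hi ↦ hfle (hneg i hi)) hI
  let φ : I → (ι → ResidueField R) × (CotangentSpace R ⧸ cotangentSpan f hfm) := fun t ↦
    (fun j ↦ residue R (b.repr t (idx j)),
      Submodule.Quotient.mk ((maximalIdeal R).toCotangent ⟨b.repr t 0, (hmem t).1 t.2⟩))
  have hadd : ∀ s t, φ (s + t) = φ s + φ t := fun s t ↦ by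
    refine Prod.ext (funext fun j ↦ by simp [φ]) ?_
    simp only [φ, Prod.snd_add]
    rw [← Submodule.Quotient.mk_add, ← map_add]
    congr 2
    ext
    simp
  have hsmul : ∀ (s : S) (t : I), φ (s • t) = residue R (b.repr s 0) • φ t := fun s t ↦ by
    refine Prod.ext (funext fun j ↦ ?_) ?_
    · simp only [φ, Prod.smul_fst, Pi.smul_apply, smul_eq_mul, ← map_mul]
      rw [← sub_eq_zero, ← map_sub, residue_eq_zero_iff]
      refine b.repr_mul_sub_mem hmul hb0 s t (idx j) fun i hi ↦ ?_
      by_cases hk : idx j - i = 0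
      · rw [hk]
        exact Ideal.mul_mem_right _ _ ((hmem t).1 t.2)
      · exact Ideal.mul_mem_left _ _ (hdec i _ j hi hk (by abel))
    · simp only [φ, Prod.smul_snd]
      have : residue R (b.repr s 0) •
          (maximalIdeal R).toCotangent ⟨b.repr t 0, (hmem t).1 t.2⟩ =
          (maximalIdeal R).toCotangent (b.repr s 0 • ⟨b.repr t 0, (hmem t).1 t.2⟩) := by
        rw [map_smul]; rfl
      rw [← Submodule.Quotient.mk_smul, this, Submodule.Quotient.eq, ← map_sub,
        toCotangent_mem_cotangentSpan_iff]
      refine Ideal.mem_sup_left (b.repr_mul_sub_mem hmul hb0 s t 0 fun i hi ↦ ?_)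
      rw [zero_sub]
      exact Ideal.mul_mem_left _ _ (hneg i hi)
  have hsurj : Function.Surjective φ := by
    rintro ⟨c, w⟩
    obtain ⟨w, rfl⟩ := Submodule.Quotient.mk_surjective _ w
    obtain ⟨w, rfl⟩ := Ideal.toCotangent_surjective _ w
    choose c' hc' using fun j ↦ residue_surjective (c j)
    have h0 : b.repr ((w : R) • b 0 + ∑ j, c' j • b (idx j)) 0 = w := by
      simp [hidx]
    have hj : ∀ j, b.repr ((w : R) • b 0 + ∑ j, c' j • b (idx j)) (idx j) = c' j := fun j ↦ by
      simp [Finsupp.single_apply, hinj.eq_iff, (hidx j).symm]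
    refine ⟨⟨(w : R) • b 0 + ∑ j, c' j • b (idx j), (hmem _).2 (by rw [h0]; exact w.2)⟩, ?_⟩
    simp only [φ, h0, hj, hc']
  have hx : x ∈ I := hxy ▸ Ideal.subset_span (by simp)
  have hy : y ∈ I := hxy ▸ Ideal.subset_span (by simp)
  have hspan : Submodule.span (ResidueField R) (Set.range ![φ ⟨x, hx⟩, φ ⟨y, hy⟩]) = ⊤ := by
    rw [eq_top_iff]
    rintro v -
    obtain ⟨⟨t, ht⟩, rfl⟩ := hsurj v
    have ht' := ht
    rw [hxy, Ideal.mem_span_pair] at ht'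
    obtain ⟨α, β, rfl⟩ := ht'
    have : φ ⟨α * x + β * y, ht⟩ = φ (α • ⟨x, hx⟩ + β • ⟨y, hy⟩) := rfl
    rw [this, hadd, hsmul, hsmul]
    exact add_mem (Submodule.smul_mem _ _ (Submodule.subset_span (by simp)))
      (Submodule.smul_mem _ _ (Submodule.subset_span (by simp)))
  have h1 := finrank_range_le_card (R := ResidueField R) ![φ ⟨x, hx⟩, φ ⟨y, hy⟩]
  rw [Set.finrank, hspan, finrank_top, Module.finrank_prod, Module.finrank_fintype_fun_eq_card] at h1
  simpa using h1

end Graded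

section Cotangent

open IsLocalRing

variable {R : Type*} [CommRing R] [IsLocalRing R]

theorem IsLocalRing.exists_maximalIdeal_eq_span_sup_span
    (hreg : ∃ x y : R, maximalIdeal R = Ideal.span {x, y}) {p : R} (hp : p ∈ maximalIdeal R)
    (hp2 : p ∉ maximalIdeal R ^ 2) : ∃ g, maximalIdeal R = Ideal.span {p} ⊔ Ideal.span {g} := by
  have key : ∀ x y a b : R, maximalIdeal R = Ideal.span {x, y} → a * x + b * y = p → IsUnit a →
      maximalIdeal R = Ideal.span {p} ⊔ Ideal.span {y} := fun x y a b hm hab ha ↦ by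
    obtain ⟨c, hc⟩ := ha.exists_left_inv
    have hy : y ∈ maximalIdeal R := hm ▸ Ideal.subset_span (by simp)
    apply le_antisymm
    · rw [← Ideal.span_union, Set.singleton_union]
      conv_lhs => rw [hm]
      rw [Ideal.span_le]
      rintro z (rfl | rfl)
      · refine Ideal.mem_span_pair.2 ⟨c, -(c * b), ?_⟩
        rw [← hab]
        linear_combination z * hc
      · exact Ideal.subset_span (by simp)
    · simp [Ideal.span_le, hp, hy, -mem_maximalIdeal]
  obtain ⟨x, y, hm⟩ := hreg
  have hx : x ∈ maximalIdeal R := hm ▸ Ideal.subset_span (by simp)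
  have hy : y ∈ maximalIdeal R := hm ▸ Ideal.subset_span (by simp)
  have hp' := hp
  rw [hm, Ideal.mem_span_pair] at hp'
  obtain ⟨a, b, hab⟩ := hp'
  by_cases ha : IsUnit a
  · exact ⟨y, key x y a b hm hab ha⟩
  by_cases hb : IsUnit b
  · exact ⟨x, key y x b a (by rw [hm, Set.pair_comm]) (by rw [← hab, add_comm]) hb⟩
  refine absurd ?_ hp2
  rw [← hab, pow_two]
  exact add_mem (Ideal.mul_mem_mul ((mem_maximalIdeal a).2 ha) hx)
    (Ideal.mul_mem_mul ((mem_maximalIdeal b).2 hb) hy)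

theorem IsLocalRing.cases_of_card_add_finrank_le [IsNoetherianRing R] (hdim : ringKrullDim R = 2)
    {rn : ℕ} {f : Fin rn → R} (hfm : ∀ j, f j ∈ maximalIdeal R)
    (h : rn + Module.finrank (ResidueField R) (CotangentSpace R ⧸ cotangentSpan f hfm) ≤ 2) :
    rn = 0 ∨ (rn = 1 ∧ ∀ i, f i ∈ maximalIdeal R ∧ f i ∉ maximalIdeal R ^ 2) ∨
      (rn = 2 ∧ maximalIdeal R = Ideal.span (Set.range f) ⊔ maximalIdeal R ^ 2) := by
  obtain rfl | rfl | rfl : rn = 0 ∨ rn = 1 ∨ rn = 2 := by omega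
  · exact Or.inl rfl
  · refine Or.inr (Or.inl ⟨rfl, fun i ↦ ⟨hfm i, fun hi ↦ ?_⟩⟩)
    have hbot : cotangentSpan f hfm = ⊥ := by
      rw [cotangentSpan, Submodule.span_eq_bot]
      rintro _ ⟨j, rfl⟩
      rw [Ideal.toCotangent_eq_zero, Subsingleton.elim j i]
      exact hi
    have h1 : Module.finrank (ResidueField R) (CotangentSpace R) ≤ 1 := by
      have := ((cotangentSpan f hfm).quotEquivOfEqBot hbot).finrank_eq
      omega
    obtain ⟨x, hx⟩ := (finrank_cotangentSpace_le_one_iff.1 h1).principal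
    exact maximalIdeal_ne_span_singleton hdim x hx
  · refine Or.inr (Or.inr ⟨rfl, le_antisymm (fun z hz ↦ ?_)
      (sup_le ?_ (Ideal.pow_le_self two_ne_zero))⟩)
    · have h0 : Module.finrank (ResidueField R) (CotangentSpace R ⧸ cotangentSpan f hfm) = 0 := by
        omega
      rw [Module.finrank_zero_iff, Submodule.Quotient.subsingleton_iff] at h0
      exact (toCotangent_mem_cotangentSpan_iff hfm ⟨z, hz⟩).1 (h0 ▸ Submodule.mem_top)
    · rw [Ideal.span_le]
      rintro _ ⟨j, rfl⟩
      exact hfm j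

end Cotangent

section Carry

/-- The carry produced when adding the standard representatives of two residues modulo `d`. -/
def ZMod.carry {d : ℕ} (x y : ZMod d) : ℕ := (x.val + y.val) / d

theorem ZMod.val_add_val_eq {d : ℕ} [NeZero d] (x y : ZMod d) :
    x.val + y.val = (x + y).val + d * x.carry y := by
  rw [ZMod.val_add, ZMod.carry, Nat.mod_add_div]

theorem ZMod.carry_eq_zero_of_lt {d : ℕ} {x y : ZMod d} (h : x.val + y.val < d) :
    x.carry y = 0 := Nat.div_eq_of_lt h

theorem ZMod.carry_zero_right {d : ℕ} [NeZero d] (x : ZMod d) : x.carry 0 = 0 :=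
  ZMod.carry_eq_zero_of_lt (by simpa using x.val_lt)

theorem ZMod.carry_neg {d : ℕ} [NeZero d] {x : ZMod d} (hx : x ≠ 0) : x.carry (-x) = 1 := by
  have : NeZero x := ⟨hx⟩
  have h := ZMod.val_add_val_eq x (-x)
  rw [ZMod.val_neg_of_ne_zero, add_neg_cancel, ZMod.val_zero,
    Nat.add_sub_cancel' x.val_lt.le, zero_add] at h
  exact (Nat.eq_of_mul_eq_mul_left (Nat.pos_of_neZero d) (by omega : d * 1 = d * _)).symm

theorem ZMod.gcd_dvd_val_mul {d : ℕ} [NeZero d] (i : ZMod d) (a : ℕ) :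
    Nat.gcd d a ∣ (i * a).val := by
  rw [ZMod.val_mul, ZMod.val_natCast, Nat.mul_mod_mod]
  exact (Nat.dvd_mod_iff (Nat.gcd_dvd_left d a)).2 ((Nat.gcd_dvd_right d a).mul_left _)

variable {rn d : ℕ} {a : Fin rn → ℕ}

theorem ZMod.exists_mul_ne_zero [NeZero d] (ha : Nat.gcd d (Finset.univ.gcd a) = 1)
    {i : ZMod d} (hi : i ≠ 0) : ∃ l, i * a l ≠ 0 := by
  by_contra! h
  apply hi
  rw [← ZMod.natCast_zmod_val i, ZMod.natCast_eq_zero_iff]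
  have h1 : d ∣ i.val * Finset.univ.gcd a := by
    have h2 : ∀ l, d ∣ i.val * a l := fun l ↦ by
      rw [← ZMod.natCast_eq_zero_iff]
      simpa using h l
    have := Finset.dvd_gcd (s := Finset.univ) (f := fun l ↦ i.val * a l) fun l _ ↦ h2 l
    rwa [Finset.gcd_mul_left, normalize_eq] at this
  exact Nat.Coprime.dvd_of_dvd_mul_right ha h1

theorem ZMod.exists_mul_eq_gcd (hd : d ≠ 0) {e : Fin rn → ℕ}
    (he : ∀ i, e i = d / Nat.gcd d (a i))
    (hcop : ∀ i j, i ≠ j → Nat.gcd (e i) (e j) = 1) (he2 : ∀ i, 2 ≤ e i) (j : Fin rn) :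
    ∃ n : ZMod d, ∀ l, n * a l = if l = j then (Nat.gcd d (a j) : ZMod d) else 0 := by
  classical
  have hg : ∀ l, Nat.gcd d (a l) * e l = d := fun l ↦ by
    rw [he, Nat.mul_div_cancel' (Nat.gcd_dvd_left _ _)]
  have hga : ∀ l, Nat.gcd d (a l) * (a l / Nat.gcd d (a l)) = a l := fun l ↦
    Nat.mul_div_cancel' (Nat.gcd_dvd_right _ _)
  have hgpos : ∀ l, 0 < Nat.gcd d (a l) := fun l ↦ Nat.gcd_pos_of_pos_left _ (Nat.pos_of_ne_zero hd)
  set M := ∏ l ∈ Finset.univ.erase j, e l with hM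
  have hMe : Nat.Coprime M (e j) := Nat.Coprime.prod_left fun l hl ↦
    hcop l j (Finset.ne_of_mem_erase hl)
  have hae : Nat.Coprime (a j / Nat.gcd d (a j)) (e j) := by
    rw [he]
    exact (Nat.coprime_div_gcd_div_gcd (hgpos j)).symm
  obtain ⟨k, -, hk⟩ := Nat.exists_mul_mod_eq_one_of_coprime (hMe.mul_left hae) (he2 j)
  refine ⟨((M * k : ℕ) : ZMod d), fun l ↦ ?_⟩
  rw [← Nat.cast_mul]
  split_ifs with h
  · subst h
    rw [ZMod.natCast_eq_natCast_iff]
    have h1 : M * (a l / Nat.gcd d (a l)) * k ≡ 1 [MOD e l] := by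
      rw [Nat.ModEq, hk, Nat.mod_eq_of_lt (he2 l)]
    have h2 := h1.mul_left' (Nat.gcd d (a l))
    rw [hg, mul_one] at h2
    convert h2 using 1
    conv_lhs => rw [← hga l]
    ring
  · rw [ZMod.natCast_eq_zero_iff]
    have h1 : e l ∣ M := Finset.dvd_prod_of_mem _ (Finset.mem_erase.2 ⟨h, Finset.mem_univ l⟩)
    have h2 := mul_dvd_mul h1 (Nat.gcd_dvd_right d (a l))
    rw [mul_comm, hg] at h2
    exact h2.trans ⟨k, by ring⟩

variable [NeZero d] {idx : Fin rn → ZMod d}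

theorem ZMod.val_gcd_of_two_le {d : ℕ} [NeZero d] {a : ℕ} (h : 2 ≤ d / Nat.gcd d a) :
    ((Nat.gcd d a : ℕ) : ZMod d).val = Nat.gcd d a := by
  refine ZMod.val_natCast_of_lt (lt_of_le_of_ne (Nat.gcd_le_left _ (Nat.pos_of_neZero d)) ?_)
  intro h1
  rw [h1, Nat.div_self (Nat.pos_of_neZero d)] at h
  omega

theorem ZMod.exists_carry_ne_zero_of_add_eq (ha : Nat.gcd d (Finset.univ.gcd a) = 1)
    (he2 : ∀ l, 2 ≤ d / Nat.gcd d (a l)) {j : Fin rn}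
    (hj : ∀ l, idx j * a l = if l = j then (Nat.gcd d (a j) : ZMod d) else 0)
    {i k : ZMod d} (hi : i ≠ 0) (hk : k ≠ 0) (hik : i + k = idx j) :
    ∃ l, (i * a l).carry (k * a l) ≠ 0 := by
  by_contra! h
  have h1 : ∀ l, (i * a l).val + (k * a l).val = (idx j * a l).val := fun l ↦ by
    rw [ZMod.val_add_val_eq, h, ← add_mul, hik, mul_zero, add_zero]
  have key : ∀ i : ZMod d, i ≠ 0 → (∀ l, l ≠ j → (i * a l).val = 0) →
      Nat.gcd d (a j) ≤ (i * a j).val := fun i hi h ↦ by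
    obtain ⟨l, hl⟩ := ZMod.exists_mul_ne_zero ha hi
    refine Nat.le_of_dvd (Nat.pos_of_ne_zero fun h0 ↦ hl ?_) (ZMod.gcd_dvd_val_mul i (a j))
    by_cases hlj : l = j
    · rw [hlj]; exact (ZMod.val_eq_zero _).1 h0
    · exact (ZMod.val_eq_zero _).1 (h l hlj)
  have h2 : ∀ l, l ≠ j → (i * a l).val + (k * a l).val = 0 := fun l hl ↦ by
    rw [h1, hj, if_neg hl, ZMod.val_zero]
  have h3 := key i hi fun l hl ↦ (Nat.add_eq_zero_iff.1 (h2 l hl)).1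
  have h4 := key k hk fun l hl ↦ (Nat.add_eq_zero_iff.1 (h2 l hl)).2
  have h5 := h1 j
  rw [hj, if_pos rfl, ZMod.val_gcd_of_two_le (he2 j)] at h5
  have := Nat.gcd_pos_of_pos_left (a j) (Nat.pos_of_neZero d)
  omega

theorem ZMod.exists_carry_sub_eq_zero (ha : Nat.gcd d (Finset.univ.gcd a) = 1)
    (he2 : ∀ l, 2 ≤ d / Nat.gcd d (a l))
    (hidx : ∀ j l, idx j * a l = if l = j then (Nat.gcd d (a j) : ZMod d) else 0)
    {i : ZMod d} (hi : i ≠ 0) :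
    ∃ j, ∀ l, ((i - idx j) * a l).carry (idx j * a l) = 0 := by
  obtain ⟨j, hj⟩ := ZMod.exists_mul_ne_zero ha hi
  refine ⟨j, fun l ↦ ?_⟩
  rw [sub_mul, hidx]
  split_ifs with h
  · subst h
    have h1 : Nat.gcd d (a l) ≤ (i * a l).val :=
      Nat.le_of_dvd (Nat.pos_of_ne_zero fun h0 ↦ hj ((ZMod.val_eq_zero _).1 h0))
        (ZMod.gcd_dvd_val_mul i (a l))
    apply ZMod.carry_eq_zero_of_lt
    have h2 := ZMod.val_gcd_of_two_le (he2 l)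
    rw [ZMod.val_sub (by rw [h2]; exact h1), h2, Nat.sub_add_cancel h1]
    exact ZMod.val_lt _
  · exact ZMod.carry_zero_right _

end Carry

section Cyclic

open Polynomial

theorem not_pow_dvd_prod_pow_of_lt {R : Type*} [CommRing R] [IsDomain R] {ι : Type*} [Fintype ι]
    {f : ι → R} (hf : ∀ i, Prime (f i)) (hfa : ∀ i j, i ≠ j → ¬ Associated (f i) (f j))
    {d : ℕ} (hd : d ≠ 0) {t : ι → ℕ} (ht : ∀ i, t i < d) {p : R} (hp : Prime p) :
    ¬ p ^ d ∣ ∏ i, f i ^ t i := by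
  classical
  intro h
  obtain ⟨l, -, hl⟩ := hp.exists_mem_finset_dvd ((dvd_pow_self p hd).trans h)
  have hass : Associated p (f l) := hp.associated_of_dvd (hf l) (hp.dvd_of_dvd_pow hl)
  have h1 : f l ^ d ∣ ∏ i, f i ^ t i := (hass.symm.pow_pow (n := d)).dvd.trans h
  rw [← Finset.mul_prod_erase _ _ (Finset.mem_univ l), ← Nat.sub_add_cancel (ht l).le, add_comm,
    pow_add, mul_dvd_mul_iff_left (pow_ne_zero _ (hf l).ne_zero)] at h1
  obtain ⟨k, hk, hk'⟩ := (hf l).exists_mem_finset_dvd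
    ((dvd_pow_self (f l) (Nat.sub_pos_of_lt (ht l)).ne').trans h1)
  exact hfa l k (Finset.ne_of_mem_erase hk).symm
    ((hf l).associated_of_dvd (hf k) ((hf l).dvd_of_dvd_pow hk'))

theorem IsFractionRing.exists_eq_of_pow_mul_prod_eq {R K : Type*} [CommRing R] [IsDomain R]
    [UniqueFactorizationMonoid R] [Field K] [Algebra R K] [IsFractionRing R K]
    {ι : Type*} [Fintype ι]
    {f : ι → R} (hf : ∀ i, Prime (f i)) (hfa : ∀ i j, i ≠ j → ¬ Associated (f i) (f j))
    {d : ℕ} (hd : d ≠ 0) {t : ι → ℕ} (ht : ∀ i, t i < d) {c : K} {r : R}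
    (h : c ^ d * algebraMap R K (∏ i, f i ^ t i) = algebraMap R K r) :
    ∃ y : R, algebraMap R K y = c := by
  set p := IsFractionRing.num R c
  set q := IsFractionRing.den R c
  have hq0 : algebraMap R K q ≠ 0 := by simp
  have hc : c = algebraMap R K p / algebraMap R K q := by
    rw [← IsFractionRing.mk'_eq_div, IsFractionRing.mk'_num_den]
  have h1 : p ^ d * ∏ i, f i ^ t i = (q : R) ^ d * r := by
    apply IsFractionRing.injective R K
    simp only [map_mul, map_pow, ← h]
    rw [(div_eq_iff hq0).1 hc.symm]
    ring
  have h2 : (q : R) ^ d ∣ ∏ i, f i ^ t i :=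
    (IsFractionRing.num_den_reduced R c).pow.symm.dvd_of_dvd_mul_left ⟨r, h1⟩
  have hqu : IsUnit (q : R) := by
    by_contra hqu
    obtain ⟨π, hπ, hπq⟩ := WfDvdMonoid.exists_irreducible_factor hqu (nonZeroDivisors.ne_zero q.2)
    exact not_pow_dvd_prod_pow_of_lt hf hfa hd ht hπ.prime ((pow_dvd_pow_of_dvd hπq d).trans h2)
  obtain ⟨w, hw⟩ := hqu.exists_right_inv
  refine ⟨p * w, ?_⟩
  rw [hc, eq_div_iff hq0, ← map_mul, mul_assoc, mul_comm w, hw, mul_one]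

theorem exists_algHom_apply_eq_mul_of_pow_eq {K L : Type*} [Field K] [Field L] [Algebra K L]
    {d : ℕ} (hd : d ≠ 0) {v : L} {c z : K} (hv : v ^ d = algebraMap K L c)
    (hgen : Algebra.adjoin K {v} = ⊤) (hdeg : Module.finrank K L = d) (hz : z ^ d = 1) :
    ∃ σ : L →ₐ[K] L, σ v = algebraMap K L z * v := by
  have hmonic : (X ^ d - C c : K[X]).Monic := monic_X_pow_sub_C _ hd
  have hvi : IsIntegral K v := ⟨X ^ d - C c, hmonic, by simp [hv]⟩
  let pb := PowerBasis.ofAdjoinEqTop hvi hgen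
  have hgenv : pb.gen = v := PowerBasis.ofAdjoinEqTop_gen hvi hgen
  have hdim : (minpoly K v).natDegree = d := by
    rw [← hgenv, PowerBasis.natDegree_minpoly, ← PowerBasis.finrank, hdeg]
  have hmin : minpoly K v = X ^ d - C c :=
    (eq_of_monic_of_dvd_of_natDegree_le (minpoly.monic hvi) hmonic
      (minpoly.dvd K v (by simp [hv])) (by rw [hdim, natDegree_X_pow_sub_C])).symm
  refine ⟨pb.lift (algebraMap K L z * v) ?_, ?_⟩
  · rw [hgenv, hmin]
    rw [map_sub, map_pow, aeval_X, aeval_C, mul_pow, ← map_pow, hz, map_one, one_mul, hv, sub_self]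
  · exact (congrArg _ hgenv.symm).trans (pb.lift_gen _ _)

theorem IsPrimitiveRoot.sum_pow_sub_add {R : Type*} [CommRing R] [IsDomain R] {ζ : R} {d : ℕ}
    (hζ : IsPrimitiveRoot ζ d) {i l : ℕ} (hi : i < d) (hl : l < d) :
    ∑ j ∈ Finset.range d, (ζ ^ (d - i) * ζ ^ l) ^ j = if l = i then (d : R) else 0 := by
  rw [← pow_add]
  split_ifs with h
  · rw [h, Nat.sub_add_cancel hi.le, hζ.pow_eq_one]
    simp
  · have h1 : ζ ^ (d - i + l) ≠ 1 := by
      rw [Ne, hζ.pow_eq_one_iff_dvd]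
      rintro ⟨k, hk⟩
      have h2 : k < 2 := by
        by_contra! h2
        have := Nat.mul_le_mul_left d h2
        omega
      interval_cases k <;> omega
    refine (mul_eq_zero.1 ?_).resolve_left (sub_ne_zero.2 h1)
    rw [mul_geom_sum, ← pow_mul, mul_comm, pow_mul, hζ.pow_eq_one, one_pow, sub_self]

variable {R K L : Type*} [CommRing R] [Field K] [Field L] [Algebra R K]
  [IsFractionRing R K] [Algebra K L] [Algebra R L] [IsScalarTower R K L]

/-- Components of an integral element along eigenvectors of an automorphism are integral. -/
theorem IsIntegral.smul_of_eigenvectors {d : ℕ} [NeZero d] {ζ : R} (hζ : IsPrimitiveRoot ζ d)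
    (hdu : IsUnit (d : R)) (σ : L →ₐ[K] L) {u : ZMod d → L}
    (hσ : ∀ i, σ (u i) = algebraMap R L ζ ^ i.val * u i) {c : ZMod d → K}
    (hs : IsIntegral R (∑ i, c i • u i)) (i : ZMod d) : IsIntegral R (c i • u i) := by
  have hσj : ∀ (j : ℕ) (l : ZMod d), (σ ^ j) (u l) = (algebraMap R L ζ ^ l.val) ^ j * u l := by
    intro j l
    induction j with
    | zero => simp
    | succ j ih =>
      have hr : σ (algebraMap R L ζ) = algebraMap R L ζ := by
        rw [IsScalarTower.algebraMap_apply R K L, AlgHom.commutes]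
      rw [pow_succ', AlgHom.mul_apply, ih, map_mul, map_pow, map_pow, hr, hσ]
      ring
  have hinj : Function.Injective (algebraMap R L) := by
    rw [IsScalarTower.algebraMap_eq R K L]
    exact (algebraMap K L).injective.comp (IsFractionRing.injective R K)
  have hζL : IsPrimitiveRoot (algebraMap R L ζ) d := hζ.map_of_injective hinj
  have key : ∑ j ∈ Finset.range d, algebraMap R L ((ζ ^ (d - i.val)) ^ j) *
      (σ ^ j) (∑ l, c l • u l) = algebraMap R L d * (c i • u i) := by
    simp only [map_sum, map_smul, hσj, Finset.mul_sum]
    rw [Finset.sum_comm]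
    have : ∀ l : ZMod d, ∑ j ∈ Finset.range d, algebraMap R L ((ζ ^ (d - i.val)) ^ j) *
        c l • ((algebraMap R L ζ ^ l.val) ^ j * u l) = if l = i then (d : L) * c i • u i else 0 := by
      intro l
      have h1 := hζL.sum_pow_sub_add i.val_lt l.val_lt
      have h2 : ∀ j, algebraMap R L ((ζ ^ (d - i.val)) ^ j) *
          c l • ((algebraMap R L ζ ^ l.val) ^ j * u l) =
          (algebraMap R L ζ ^ (d - i.val) * algebraMap R L ζ ^ l.val) ^ j * c l • u l := fun j ↦ by
        rw [mul_pow, map_pow, map_pow, ← smul_mul_assoc]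
        simp only [Algebra.smul_def]
        ring
      simp only [h2]
      rw [← Finset.sum_mul, h1]
      by_cases hli : l = i
      · simp [hli]
      · rw [if_neg hli, if_neg (fun h ↦ hli (ZMod.val_injective d h)), zero_mul]
    rw [Finset.sum_congr rfl fun l _ ↦ this l]
    simp
  have hint : IsIntegral R (algebraMap R L d * (c i • u i)) := by
    rw [← key]
    exact IsIntegral.sum _ fun j _ ↦ isIntegral_algebraMap.mul
      (hs.map ((σ ^ j).restrictScalars R))
  obtain ⟨w, hw⟩ := hdu.exists_left_inv
  have := (isIntegral_algebraMap (R := R) (A := L) (x := w)).mul hint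
  rwa [← mul_assoc, ← map_mul, hw, map_one, one_mul] at this

theorem ZMod.add_val_mul_div {d : ℕ} [NeZero d] (a : ℕ) (i j : ZMod d) :
    (i + j).val * a / d + i.carry j * a =
      (i * a).carry (j * a) + (i.val * a / d + j.val * a / d) := by
  have hv : ∀ i : ZMod d, (i * a).val + d * (i.val * a / d) = i.val * a := fun i ↦ by
    rw [ZMod.val_mul, ZMod.val_natCast, Nat.mul_mod_mod, Nat.mod_add_div]
  have h1 := ZMod.val_add_val_eq i j
  have h2 := ZMod.val_add_val_eq (i * (a : ZMod d)) (j * a)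
  rw [← add_mul] at h2
  have h3 := hv i
  have h4 := hv j
  have h5 := hv (i + j)
  have h6 : (i.val + j.val) * a = ((i + j).val + d * i.carry j) * a := by rw [h1]
  apply Nat.eq_of_mul_eq_mul_left (Nat.pos_of_neZero d)
  nlinarith

/-- The normalization of `R` in a cyclic extension generated by a `d`-th root of `∏ fᵢ ^ aᵢ` is a
twisted group algebra of `ZMod d`. -/
theorem exists_basis_integralClosure_of_pow_eq [IsDomain R] [UniqueFactorizationMonoid R]
    {d : ℕ} [NeZero d] {ζ : R} (hζ : IsPrimitiveRoot ζ d) (hdu : IsUnit (d : R))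
    {ι : Type*} [Fintype ι] {f : ι → R} (a : ι → ℕ)
    (hf : ∀ i, Prime (f i)) (hfa : ∀ i j, i ≠ j → ¬ Associated (f i) (f j))
    {v : L} (hv : v ^ d = algebraMap R L (∏ i, f i ^ a i))
    (hgen : Algebra.adjoin K {v} = ⊤) (hdeg : Module.finrank K L = d) :
    ∃ b : Module.Basis (ZMod d) R (integralClosure R L), b 0 = 1 ∧
      ∀ i j, b i * b j = (∏ l, f l ^ (i * (a l : ZMod d)).carry (j * a l)) • b (i + j) := by
  classical
  have hd : d ≠ 0 := NeZero.ne d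
  have hinj : Function.Injective (algebraMap R L) := by
    rw [IsScalarTower.algebraMap_eq R K L]
    exact (algebraMap K L).injective.comp (IsFractionRing.injective R K)
  have hprod : ∀ t : ι → ℕ, algebraMap R L (∏ l, f l ^ t l) ≠ 0 := fun t ↦ by
    rw [Ne, map_eq_zero_iff _ hinj]
    exact Finset.prod_ne_zero_iff.2 fun l _ ↦ pow_ne_zero _ (hf l).ne_zero
  have hv0 : v ≠ 0 := fun h ↦ hprod a (by rw [← hv, h, zero_pow hd])
  obtain ⟨σ, hσ⟩ := exists_algHom_apply_eq_mul_of_pow_eq hd (c := algebraMap R K (∏ i, f i ^ a i))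
    (z := algebraMap R K ζ) (by rw [hv, IsScalarTower.algebraMap_apply R K L]) hgen hdeg
    (by rw [← map_pow, hζ.pow_eq_one, map_one])
  rw [← IsScalarTower.algebraMap_apply R K L] at hσ
  let P : ZMod d → L := fun i ↦ algebraMap R L (∏ l, f l ^ (i.val * a l / d))
  let u : ZMod d → L := fun i ↦ v ^ i.val / P i
  have hP0 : ∀ i, P i ≠ 0 := fun i ↦ hprod _
  have huP : ∀ i, u i * P i = v ^ i.val := fun i ↦ div_mul_cancel₀ _ (hP0 i)
  have hu0 : ∀ i, u i ≠ 0 := fun i ↦ div_ne_zero (pow_ne_zero _ hv0) (hP0 i)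
  have hud : ∀ i, u i ^ d = algebraMap R L (∏ l, f l ^ (i * (a l : ZMod d)).val) := fun i ↦ by
    apply mul_right_cancel₀ (pow_ne_zero d (hP0 i))
    rw [← mul_pow, huP, ← pow_mul, mul_comm, pow_mul, hv]
    simp only [P, ← map_pow, ← map_mul, ← Finset.prod_pow, ← Finset.prod_mul_distrib]
    congr 1
    refine Finset.prod_congr rfl fun l _ ↦ ?_
    rw [← pow_mul, ← pow_mul, ← pow_add, ZMod.val_mul, ZMod.val_natCast, Nat.mul_mod_mod,
      mul_comm (_ / d), Nat.mod_add_div, mul_comm]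
  have hu1 : u 0 = 1 := by simp [u, P]
  have humul : ∀ i j, u i * u j =
      algebraMap R L (∏ l, f l ^ (i * (a l : ZMod d)).carry (j * a l)) * u (i + j) := fun i j ↦ by
    apply mul_right_cancel₀ (mul_ne_zero (hP0 i) (hP0 j))
    have h1 : v ^ i.val * v ^ j.val = v ^ (i + j).val * (v ^ d) ^ i.carry j := by
      rw [← pow_add, ZMod.val_add_val_eq, pow_add, pow_mul]
    have h2 : P (i + j) * (v ^ d) ^ i.carry j =
        algebraMap R L (∏ l, f l ^ (i * (a l : ZMod d)).carry (j * a l)) * (P i * P j) := by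
      rw [hv]
      simp only [P, ← map_pow, ← map_mul, ← Finset.prod_pow, ← Finset.prod_mul_distrib]
      congr 1
      refine Finset.prod_congr rfl fun l _ ↦ ?_
      rw [← pow_mul, ← pow_add, ← pow_add, ← pow_add, mul_comm (a l), ZMod.add_val_mul_div]
    calc u i * u j * (P i * P j) = (u i * P i) * (u j * P j) := by ring
      _ = u (i + j) * (P (i + j) * (v ^ d) ^ i.carry j) := by
        rw [huP, huP, h1, ← huP (i + j)]; ring
      _ = _ := by rw [h2]; ring
  have hint : ∀ i, IsIntegral R (u i) := fun i ↦
    IsIntegral.of_pow (Nat.pos_of_ne_zero hd) (by rw [hud]; exact isIntegral_algebraMap)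
  have hσu : ∀ i, σ (u i) = algebraMap R L ζ ^ i.val * u i := fun i ↦ by
    have hr : ∀ r : R, σ (algebraMap R L r) = algebraMap R L r := fun r ↦ by
      rw [IsScalarTower.algebraMap_apply R K L, AlgHom.commutes]
    simp only [u, P, map_div₀, map_pow, hr, hσ, mul_pow, mul_div_assoc]
  have hζK : IsPrimitiveRoot (algebraMap R K ζ) d :=
    hζ.map_of_injective (IsFractionRing.injective R K)
  have hli : LinearIndependent K u := by
    refine Module.End.eigenvectors_linearIndependent' σ.toLinearMap
      (fun i : ZMod d ↦ algebraMap R K ζ ^ i.val) (fun i j hij ↦ ?_) u fun i ↦ ⟨?_, hu0 i⟩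
    · exact ZMod.val_injective d (hζK.pow_inj i.val_lt j.val_lt hij)
    · rw [Module.End.mem_eigenspace_iff, Algebra.smul_def, map_pow,
        ← IsScalarTower.algebraMap_apply R K L]
      exact hσu i
  have hcard : Fintype.card (ZMod d) = Module.finrank K L := by rw [ZMod.card, hdeg]
  let B := basisOfLinearIndependentOfCardEqFinrank hli hcard
  have hB : ∀ i, B i = u i := fun i ↦ by simp [B]
  let w : ZMod d → integralClosure R L := fun i ↦ ⟨u i, hint i⟩
  have hwli : LinearIndependent R w := by
    refine LinearIndependent.of_comp (integralClosure R L).val.toLinearMap ?_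
    refine LinearIndependent.restrict_scalars (K := K) (fun x y hxy ↦ ?_) hli
    exact IsFractionRing.injective R K (by simpa [Algebra.smul_def] using hxy)
  have hwspan : ⊤ ≤ Submodule.span R (Set.range w) := by
    rintro ⟨s, hs⟩ -
    have hs' : ∑ i, B.repr s i • u i = s := by simpa [hB] using B.sum_repr s
    have hc : ∀ i, ∃ y : R, algebraMap R K y = B.repr s i := fun i ↦ by
      have h1 : IsIntegral R (B.repr s i • u i) :=
        IsIntegral.smul_of_eigenvectors hζ hdu σ hσu (c := B.repr s) (by rw [hs']; exact hs) i
      have h2 := h1.pow d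
      rw [_root_.smul_pow, hud, IsScalarTower.algebraMap_apply R K L, Algebra.smul_def, ← map_mul,
        isIntegral_algebraMap_iff (algebraMap K L).injective, IsIntegrallyClosed.isIntegral_iff]
        at h2
      obtain ⟨r, hr⟩ := h2
      exact IsFractionRing.exists_eq_of_pow_mul_prod_eq hf hfa hd (fun l ↦ ZMod.val_lt _) hr.symm
    choose c hc using hc
    rw [Submodule.mem_span_range_iff_exists_fun]
    refine ⟨c, Subtype.ext (Eq.trans ?_ hs')⟩
    simp [w, ← hc, Algebra.smul_def, IsScalarTower.algebraMap_apply R K L]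
  refine ⟨Module.Basis.mk hwli hwspan, ?_, fun i j ↦ ?_⟩
  · rw [Module.Basis.mk_apply]
    exact Subtype.ext hu1
  · simp only [Module.Basis.mk_apply]
    refine Subtype.ext ?_
    rw [Algebra.smul_def]
    exact humul i j

end Cyclic

/-- With notation as in Statement 5 (`S` the normalization of the regular
complete local 2-dimensional domain `R` in `L = K[v]/(v^d − f)`, with `eᵢ ≥ 2` pairwise
relatively prime), `S` is regular if and only if one of the following holds:
(a) `r = 0`; (b) `r = 1` and `f₁ ∈ 𝔪 ∖ 𝔪²`; (c) `r = 2` and `𝔪 = (f₁, f₂) + 𝔪²`. -/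
theorem stmt6 (R : Type*) [CommRing R] [IsDomain R] [IsLocalRing R] [IsNoetherianRing R]
    [IsAdicComplete (IsLocalRing.maximalIdeal R) R]
    (hreg : ∃ x y : R, IsLocalRing.maximalIdeal R = Ideal.span {x, y})
    (hdim : ringKrullDim R = 2)
    [IsAlgClosed (IsLocalRing.ResidueField R)]
    (d : ℕ) (hd : 2 ≤ d) (hdu : IsUnit (d : R))
    (K L : Type*) [Field K] [Field L] [Algebra R K] [IsFractionRing R K]
    [Algebra K L] [Algebra R L] [IsScalarTower R K L]
    (rn : ℕ) (f : Fin rn → R) (a : Fin rn → ℕ)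
    (hfi : ∀ i, Irreducible (f i))
    (hfa : ∀ i j, i ≠ j → ¬ Associated (f i) (f j))
    (ha : Nat.gcd d (Finset.univ.gcd a) = 1)
    (F : R) (hF : F = ∏ i, f i ^ a i) (hF0 : F ≠ 0)
    (v : L) (hv : v ^ d = algebraMap R L F)
    (hgen : Algebra.adjoin K {v} = ⊤) (hdeg : Module.finrank K L = d)
    (e : Fin rn → ℕ) (he : ∀ i, e i = d / Nat.gcd d (a i))
    (hcop : ∀ i j, i ≠ j → Nat.gcd (e i) (e j) = 1)
    (he2 : ∀ i, 2 ≤ e i) :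
    (∀ I : Ideal (integralClosure R L), I.IsMaximal →
        ∃ x y : integralClosure R L, I = Ideal.span {x, y}) ↔
      (rn = 0 ∨
        (rn = 1 ∧ ∀ i, f i ∈ IsLocalRing.maximalIdeal R ∧
          f i ∉ IsLocalRing.maximalIdeal R ^ 2) ∨
        (rn = 2 ∧ IsLocalRing.maximalIdeal R =
          Ideal.span (Set.range f) ⊔ IsLocalRing.maximalIdeal R ^ 2)) := by
  have hd0 : d ≠ 0 := by omega
  have : NeZero d := ⟨hd0⟩
  have := IsLocalRing.uniqueFactorizationMonoid_of_maximalIdeal_eq_span_pair hreg hdim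
  obtain ⟨ζ, hζ⟩ := IsLocalRing.exists_root_one_of_isAdicComplete (R := R) d hd0 hdu
  subst hF
  obtain ⟨b, hb0, hmul⟩ := exists_basis_integralClosure_of_pow_eq hζ hdu a
    (fun i ↦ (hfi i).prime) hfa hv hgen hdeg
  have hfm : ∀ i, f i ∈ IsLocalRing.maximalIdeal R := fun i ↦
    (IsLocalRing.mem_maximalIdeal _).2 (hfi i).not_isUnit
  have he2' : ∀ l, 2 ≤ d / Nat.gcd d (a l) := fun l ↦ he l ▸ he2 l
  choose idx hidx using ZMod.exists_mul_eq_gcd hd0 he hcop he2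
  have hgcd : ∀ j, (Nat.gcd d (a j) : ZMod d) ≠ 0 := fun j h ↦ by
    have := ZMod.val_gcd_of_two_le (he2' j)
    rw [h, ZMod.val_zero] at this
    exact hd0 (Nat.eq_zero_of_gcd_eq_zero_left this.symm)
  have hidx0 : ∀ j, idx j ≠ 0 := fun j h ↦ hgcd j (by simpa [h] using (hidx j j).symm)
  have hinj : Function.Injective idx := fun j k hjk ↦ by
    by_contra hne
    apply hgcd j
    have h1 := hidx j j
    rwa [if_pos rfl, hjk, hidx, if_neg hne, eq_comm] at h1
  have hdvd : ∀ (i k : ZMod d) l, (i * a l).carry (k * a l) ≠ 0 →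
      f l ∣ ∏ l, f l ^ (i * (a l : ZMod d)).carry (k * a l) := fun i k l hl ↦
    (dvd_pow_self _ hl).trans (Finset.dvd_prod_of_mem _ (Finset.mem_univ l))
  have hneg : ∀ i : ZMod d, i ≠ 0 → ∏ l, f l ^ (i * (a l : ZMod d)).carry (-i * a l) ∈
      Ideal.span (Set.range f) := fun i hi ↦ by
    obtain ⟨l, hl⟩ := ZMod.exists_mul_ne_zero ha hi
    refine Ideal.mem_of_dvd _ (hdvd i (-i) l ?_) (Ideal.subset_span ⟨l, rfl⟩)
    rw [neg_mul, ZMod.carry_neg hl]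
    exact one_ne_zero
  have hneg' : ∀ i : ZMod d, i ≠ 0 → ∏ l, f l ^ (i * (a l : ZMod d)).carry (-i * a l) ∈
      IsLocalRing.maximalIdeal R := fun i hi ↦ by
    refine (Ideal.span_le.2 ?_ : Ideal.span (Set.range f) ≤ _) (hneg i hi)
    rintro _ ⟨j, rfl⟩
    exact hfm j
  have hdec : ∀ i k j, i ≠ 0 → k ≠ 0 → i + k = idx j →
      ∏ l, f l ^ (i * (a l : ZMod d)).carry (k * a l) ∈ IsLocalRing.maximalIdeal R := by
    intro i k j hi hk hik
    obtain ⟨l, hl⟩ := ZMod.exists_carry_ne_zero_of_add_eq ha he2' (hidx j) hi hk hik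
    exact Ideal.mem_of_dvd _ (hdvd i k l hl) (hfm l)
  have hcarry : ∀ i, i ≠ 0 →
      ∃ j, ∏ l, f l ^ ((i - idx j) * (a l : ZMod d)).carry (idx j * a l) = 1 := fun i hi ↦ by
    obtain ⟨j, hj⟩ := ZMod.exists_carry_sub_eq_zero ha he2' hidx hi
    exact ⟨j, by simp [hj]⟩
  have hfθ : ∀ j, ∏ l, f l ^ (idx j * (a l : ZMod d)).carry (-idx j * a l) = f j := fun j ↦ by
    rw [Finset.prod_eq_single j]
    · rw [neg_mul, ZMod.carry_neg (by rw [hidx, if_pos rfl]; exact hgcd j), pow_one]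
    · intro l _ hl
      rw [neg_mul, hidx, if_neg hl, neg_zero, ZMod.carry_zero_right, pow_zero]
    · simp
  have hspan := fun (J : Ideal R)
      (hJ : IsLocalRing.maximalIdeal R = Ideal.span (Set.range f) ⊔ J)
      (I : Ideal (integralClosure R L)) (hI : I.IsMaximal) ↦
    b.isMaximal_eq_span_of_twisted hmul hb0 hneg' hidx0 hcarry hfθ hJ hI
  constructor
  · intro h
    obtain ⟨I, hI⟩ := Ideal.exists_maximal (integralClosure R L)
    obtain ⟨x, y, hxy⟩ := h I hI
    refine IsLocalRing.cases_of_card_add_finrank_le hdim hfm ?_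
    simpa using b.card_add_finrank_le_of_twisted hfm hmul hb0 hneg hidx0 hinj hdec hI hxy
  · rintro (rfl | ⟨rfl, hf1⟩ | ⟨rfl, hf2⟩) I hI
    · simp at ha
      omega
    · obtain ⟨g, hg⟩ :=
        IsLocalRing.exists_maximalIdeal_eq_span_sup_span hreg (hf1 0).1 (hf1 0).2
      refine ⟨b (idx 0), algebraMap R _ g, ?_⟩
      rw [hspan (Ideal.span {g}) (by rwa [Set.range_unique]) I hI, Set.range_unique,
        Ideal.map_span, Set.image_singleton, ← Ideal.span_union, Set.singleton_union]
      rfl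
    · have hm : IsLocalRing.maximalIdeal R = Ideal.span (Set.range f) ⊔ ⊥ := by
        rw [sup_bot_eq]
        refine le_antisymm (IsLocalRing.ideal_le_of_le_sup_maximalIdeal_mul ?_)
          (le_sup_left.trans hf2.ge)
        rw [← pow_two]
        exact hf2.le
      refine ⟨b (idx 0), b (idx 1), ?_⟩
      rw [hspan ⊥ hm I hI, Ideal.map_bot, sup_bot_eq]
      congr 1
      ext
      simp [Fin.exists_fin_two, eq_comm]
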